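/- Fix F ≥ 1, D ≥ 1, a decision function σ, and inputs x_i, x_j ∈ ℝ^F. Then the empirical NTK at the NTK initialization of an ensemble of M soft decision lists of depth D, Θ̂₀^M(x_i,x_j), converges in probability as M → ∞ to the deterministic value Θ^{(D,DL)}(x_i,x_j) = ∑_{d=1}^{D−1} Θ^{(d,Rule)}(x_i,x_j) + 2·Θ^{(D,Rule)}(x_i,x_j) = Σ(x_i,x_j)·Ṫ(x_i,x_j)·( ∑_{d=1}^{D} d·T(x_i,x_j)^{d−1} + D·T(x_i,x_j)^{D−1} ) + ∑_{d=1}^{D} T(x_i,x_j)^d + T(x_i,x_j)^D. -/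

import Mathlib

open MeasureTheory ProbabilityTheory Filter

noncomputable section

/-- Euclidean inner product on `ℝ^F`. -/
def dot {F : ℕ} (u x : Fin F → ℝ) : ℝ := ∑ k, u k * x k

/-- Standard Gaussian measure on `ℝ^F` (zero mean, identity covariance). -/
def stdGauss (F : ℕ) : Measure (Fin F → ℝ) := Measure.pi fun _ => gaussianReal 0 1

/-- `T(x_i,x_j) = E[σ(uᵀx_i)·σ(uᵀx_j)]` for `u` standard Gaussian. -/
def Tker {F : ℕ} (σ : ℝ → ℝ) (xi xj : Fin F → ℝ) : ℝ :=
  ∫ u, σ (dot u xi) * σ (dot u xj) ∂ stdGauss F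

/-- `Ṫ(x_i,x_j) = E[σ̇(uᵀx_i)·σ̇(uᵀx_j)]` for `u` standard Gaussian. -/
def Tdot {F : ℕ} (σ : ℝ → ℝ) (xi xj : Fin F → ℝ) : ℝ :=
  ∫ u, deriv σ (dot u xi) * deriv σ (dot u xj) ∂ stdGauss F

/-- A decision function: differentiable with bounded derivative, values in [0,1],
and `σ(p) + σ(−p) = 1`. -/
structure IsDecisionFunc (σ : ℝ → ℝ) : Prop where
  differentiable : Differentiable ℝ σ
  deriv_bounded : ∃ C : ℝ, ∀ p : ℝ, |deriv σ p| ≤ C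
  mem_Icc : ∀ p : ℝ, σ p ∈ Set.Icc (0:ℝ) 1
  symm : ∀ p : ℝ, σ p + σ (-p) = 1

/-- A tree architecture: a finite full binary tree. -/
inductive BTree where
  | leaf : BTree
  | node : BTree → BTree → BTree

namespace BTree

/-- Root-to-leaf paths (`true` = go to the left child). -/
def leafPaths : BTree → List (List Bool)
  | .leaf => [[]]
  | .node l r => l.leafPaths.map (List.cons true) ++ r.leafPaths.map (List.cons false)

/-- Addresses of internal nodes. -/
def nodePaths : BTree → List (List Bool)
  | .leaf => []
  | .node l r => [] :: (l.nodePaths.map (List.cons true) ++ r.nodePaths.map (List.cons false))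

/-- Maximal leaf depth. -/
def depth : BTree → ℕ
  | .leaf => 0
  | .node l r => max l.depth r.depth + 1

/-- `Q(d)`: the number of leaves at depth `d`. -/
def Q (t : BTree) (d : ℕ) : ℕ := (t.leafPaths.filter fun p => p.length = d).length

def nodeFinset (t : BTree) : Finset (List Bool) := t.nodePaths.toFinset
def leafFinset (t : BTree) : Finset (List Bool) := t.leafPaths.toFinset

end BTree

/-- Index type for the scalar trainable parameters of a single soft tree with
architecture `t` on `ℝ^F`: one scalar per coordinate of each internal-node weight
vector, and one scalar per leaf. -/
abbrev TParam (t : BTree) (F : ℕ) : Type := (↥t.nodeFinset × Fin F) ⊕ ↥t.leafFinset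

/-- The internal-node weight vector at address `a`, read from a parameter vector. -/
def wOf (t : BTree) {F : ℕ} (θ : TParam t F → ℝ) (a : List Bool) : Fin F → ℝ :=
  fun k => if h : a ∈ t.nodeFinset then θ (Sum.inl (⟨a, h⟩, k)) else 0

/-- The leaf value at leaf address `a`, read from a parameter vector. -/
def piOf (t : BTree) {F : ℕ} (θ : TParam t F → ℝ) (a : List Bool) : ℝ :=
  if h : a ∈ t.leafFinset then θ (Sum.inr ⟨a, h⟩) else 0

/-- Product along a root-to-leaf path of `p` (at a node passed leftwards) or `1 - p`
(passed rightwards), where `p` assigns a real to every node address. -/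
def pathProd (p : List Bool → ℝ) : List Bool → ℝ
  | [] => 1
  | b :: rest => (if b then p [] else 1 - p []) * pathProd (fun a => p (b :: a)) rest

/-- Output of a single soft tree: `f(x) = ∑_ℓ π_ℓ · μ_ℓ(x, w)`. -/
def treeF {F : ℕ} (σ : ℝ → ℝ) (t : BTree) (θ : TParam t F → ℝ) (x : Fin F → ℝ) : ℝ :=
  (t.leafPaths.map fun path =>
    piOf t θ path * pathProd (fun a => σ (dot (wOf t θ a) x)) path).sum

/-- Output of an ensemble of `M` soft trees: `f^M(x) = (1/√M) ∑_m f_m(x)`. -/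
def ensembleF {F : ℕ} (σ : ℝ → ℝ) (t : BTree) (M : ℕ) (θ : Fin M × TParam t F → ℝ)
    (x : Fin F → ℝ) : ℝ :=
  (1 / Real.sqrt M) * ∑ m : Fin M, treeF σ t (fun p => θ (m, p)) x

/-- Partial derivative of `g` with respect to the scalar parameter indexed by `q`. -/
def pderiv {ι : Type} [DecidableEq ι] (g : (ι → ℝ) → ℝ) (θ : ι → ℝ) (q : ι) : ℝ :=
  deriv (fun s => g (Function.update θ q s)) (θ q)

/-- Empirical NTK of a model `g` with scalar parameters indexed by `ι`:
`Θ̂(x_i,x_j) = ∑_θ (∂g(x_i)/∂θ)·(∂g(x_j)/∂θ)`. -/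
def empNTK {ι : Type} [Fintype ι] [DecidableEq ι] {F : ℕ}
    (g : (ι → ℝ) → (Fin F → ℝ) → ℝ) (θ : ι → ℝ) (xi xj : Fin F → ℝ) : ℝ :=
  ∑ q : ι, pderiv (fun θ' => g θ' xi) θ q * pderiv (fun θ' => g θ' xj) θ q

/-- NTK initialization: all scalar parameters are i.i.d. standard Gaussian. -/
def initMeasure (ι : Type) [Fintype ι] : Measure (ι → ℝ) :=
  Measure.pi fun _ => gaussianReal 0 1

/-- The decision list of depth `D`: a binary tree growing in only one direction, with one
leaf at each depth `1,…,D−1` and two leaves at depth `D` (`dlist D` for `D ≥ 1`). -/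
def dlist : ℕ → BTree
  | 0 => .leaf
  | n + 1 => .node .leaf (dlist n)

/-- The limiting rule-set NTK:
`Θ^{(d,Rule)}(x_i,x_j) = d·Σ(x_i,x_j)·T(x_i,x_j)^{d−1}·Ṫ(x_i,x_j) + T(x_i,x_j)^d`. -/
def thetaRule {F : ℕ} (σ : ℝ → ℝ) (d : ℕ) (xi xj : Fin F → ℝ) : ℝ :=
  (d : ℝ) * dot xi xj * (Tker σ xi xj)^(d-1) * Tdot σ xi xj + (Tker σ xi xj)^d

def dlMap (n F : ℕ) : Fin F ⊕ (Unit ⊕ TParam (dlist n) F) → TParam (dlist (n+1)) F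
  | Sum.inl k => Sum.inl (⟨[], by simp [dlist, BTree.nodeFinset, BTree.nodePaths]⟩, k)
  | Sum.inr (Sum.inl _) =>
      Sum.inr ⟨[true], by simp [dlist, BTree.leafFinset, BTree.leafPaths]⟩
  | Sum.inr (Sum.inr (Sum.inl (a, k))) =>
      Sum.inl (⟨false :: a.1, by
        have := a.2
        simpa [dlist, BTree.nodeFinset, BTree.nodePaths] using this⟩, k)
  | Sum.inr (Sum.inr (Sum.inr a)) =>
      Sum.inr ⟨false :: a.1, by
        have := a.2
        simpa [dlist, BTree.leafFinset, BTree.leafPaths] using this⟩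

lemma dlMap_bij (n F : ℕ) : Function.Bijective (dlMap n F) := by
  constructor
  · rintro (k | (u | (⟨⟨a, ha⟩, k⟩ | ⟨a, ha⟩))) (k' | (u' | (⟨⟨a', ha'⟩, k'⟩ | ⟨a', ha'⟩))) h <;>
      simp_all [dlMap]
  · rintro (⟨⟨a, ha⟩, k⟩ | ⟨a, ha⟩)
    · have h := ha
      simp only [dlist, BTree.nodeFinset, BTree.nodePaths, List.mem_toFinset, List.mem_cons,
        List.map_nil, List.nil_append, List.mem_map] at h
      rcases h with rfl | ⟨b, hb, rfl⟩
      · exact ⟨Sum.inl k, rfl⟩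
      · exact ⟨Sum.inr (Sum.inr (Sum.inl (⟨b, by simpa [BTree.nodeFinset] using hb⟩, k))), rfl⟩
    · have h := ha
      simp only [dlist, BTree.leafFinset, BTree.leafPaths, List.mem_toFinset, List.mem_cons,
        List.map_nil, List.map_cons, List.cons_append, List.nil_append, List.mem_map] at h
      rcases h with rfl | ⟨b, hb, rfl⟩
      · exact ⟨Sum.inr (Sum.inl ()), rfl⟩
      · exact ⟨Sum.inr (Sum.inr (Sum.inr ⟨b, by simpa [BTree.leafFinset] using hb⟩)), rfl⟩

def dlE (n F : ℕ) : Fin F ⊕ (Unit ⊕ TParam (dlist n) F) ≃ TParam (dlist (n+1)) F :=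
  Equiv.ofBijective _ (dlMap_bij n F)

def dlA (n F : ℕ) (θ : TParam (dlist (n+1)) F → ℝ) : Fin F → ℝ := fun k => θ (dlE n F (Sum.inl k))
def dlB (n F : ℕ) (θ : TParam (dlist (n+1)) F → ℝ) : ℝ := θ (dlE n F (Sum.inr (Sum.inl ())))
def dlC (n F : ℕ) (θ : TParam (dlist (n+1)) F → ℝ) : TParam (dlist n) F → ℝ :=
  fun q => θ (dlE n F (Sum.inr (Sum.inr q)))

lemma treeF_zero {F : ℕ} (σ : ℝ → ℝ) (θ : TParam (dlist 0) F → ℝ) (x : Fin F → ℝ) :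
    treeF σ (dlist 0) θ x = θ (Sum.inr ⟨[], by simp [dlist, BTree.leafFinset, BTree.leafPaths]⟩) := by
  simp [treeF, dlist, BTree.leafPaths, pathProd, piOf, BTree.leafFinset]

lemma wOf_nil {F n : ℕ} (θ : TParam (dlist (n+1)) F → ℝ) :
    wOf (dlist (n+1)) θ [] = dlA n F θ := by
  funext k
  have h : [] ∈ (dlist (n+1)).nodeFinset := by simp [dlist, BTree.nodeFinset, BTree.nodePaths]
  simp only [wOf, h, dif_pos]
  rfl

lemma wOf_cons {F n : ℕ} (θ : TParam (dlist (n+1)) F → ℝ) (a : List Bool) :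
    wOf (dlist (n+1)) θ (false :: a) = wOf (dlist n) (dlC n F θ) a := by
  funext k
  have h : false :: a ∈ (dlist (n+1)).nodeFinset ↔ a ∈ (dlist n).nodeFinset := by
    simp [dlist, BTree.nodeFinset, BTree.nodePaths]
  by_cases h' : a ∈ (dlist n).nodeFinset
  · simp only [wOf, h, h', dif_pos]
    rfl
  · simp only [wOf, h, h', dif_neg, not_false_eq_true]

lemma piOf_true {F n : ℕ} (θ : TParam (dlist (n+1)) F → ℝ) :
    piOf (dlist (n+1)) θ [true] = dlB n F θ := by
  have h : [true] ∈ (dlist (n+1)).leafFinset := by simp [dlist, BTree.leafFinset, BTree.leafPaths]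
  simp only [piOf, h, dif_pos]
  rfl

lemma piOf_cons {F n : ℕ} (θ : TParam (dlist (n+1)) F → ℝ) (a : List Bool) :
    piOf (dlist (n+1)) θ (false :: a) = piOf (dlist n) (dlC n F θ) a := by
  have h : false :: a ∈ (dlist (n+1)).leafFinset ↔ a ∈ (dlist n).leafFinset := by
    simp [dlist, BTree.leafFinset, BTree.leafPaths]
  by_cases h' : a ∈ (dlist n).leafFinset
  · simp only [piOf, h, h', dif_pos]
    rfl
  · simp only [piOf, h, h', dif_neg, not_false_eq_true]

lemma treeF_succ {F : ℕ} (σ : ℝ → ℝ) (n : ℕ) (θ : TParam (dlist (n+1)) F → ℝ) (x : Fin F → ℝ) :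
    treeF σ (dlist (n+1)) θ x = σ (dot (dlA n F θ) x) * dlB n F θ
      + (1 - σ (dot (dlA n F θ) x)) * treeF σ (dlist n) (dlC n F θ) x := by
  have hp : (dlist (n+1)).leafPaths = [true] :: (dlist n).leafPaths.map (List.cons false) := by
    simp [dlist, BTree.leafPaths]
  unfold treeF
  rw [hp, List.map_cons, List.sum_cons, List.map_map, ← List.sum_map_mul_left]
  congr 1
  · rw [piOf_true]
    simp [pathProd, wOf_nil, mul_comm]
  · congr 1
    apply List.map_congr_left
    intro a _
    simp only [Function.comp, pathProd, piOf_cons, wOf_cons, wOf_nil]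
    simp
    ring

lemma dlA_update_inl {F n : ℕ} (θ : TParam (dlist (n+1)) F → ℝ) (k : Fin F) (s : ℝ) :
    dlA n F (Function.update θ (dlE n F (Sum.inl k)) s) = Function.update (dlA n F θ) k s := by
  funext j; simp [dlA, Function.update_apply]
lemma dlB_update_inl {F n : ℕ} (θ : TParam (dlist (n+1)) F → ℝ) (k : Fin F) (s : ℝ) :
    dlB n F (Function.update θ (dlE n F (Sum.inl k)) s) = dlB n F θ := by
  simp [dlB, Function.update_apply]
lemma dlC_update_inl {F n : ℕ} (θ : TParam (dlist (n+1)) F → ℝ) (k : Fin F) (s : ℝ) :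
    dlC n F (Function.update θ (dlE n F (Sum.inl k)) s) = dlC n F θ := by
  funext j; simp [dlC, Function.update_apply]
lemma dlA_update_inr {F n : ℕ} (θ : TParam (dlist (n+1)) F → ℝ) (q) (s : ℝ) :
    dlA n F (Function.update θ (dlE n F (Sum.inr q)) s) = dlA n F θ := by
  funext j; simp [dlA, Function.update_apply]
lemma dlB_update_b {F n : ℕ} (θ : TParam (dlist (n+1)) F → ℝ) (u) (s : ℝ) :
    dlB n F (Function.update θ (dlE n F (Sum.inr (Sum.inl u))) s) = s := by
  simp [dlB, Function.update_apply]
lemma dlC_update_b {F n : ℕ} (θ : TParam (dlist (n+1)) F → ℝ) (u) (s : ℝ) :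
    dlC n F (Function.update θ (dlE n F (Sum.inr (Sum.inl u))) s) = dlC n F θ := by
  funext j; simp [dlC, Function.update_apply]
lemma dlB_update_c {F n : ℕ} (θ : TParam (dlist (n+1)) F → ℝ) (q) (s : ℝ) :
    dlB n F (Function.update θ (dlE n F (Sum.inr (Sum.inr q))) s) = dlB n F θ := by
  simp [dlB, Function.update_apply]
lemma dlC_update_c {F n : ℕ} (θ : TParam (dlist (n+1)) F → ℝ) (q) (s : ℝ) :
    dlC n F (Function.update θ (dlE n F (Sum.inr (Sum.inr q))) s)
      = Function.update (dlC n F θ) q s := by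
  funext j; simp only [dlC, Function.update_apply, EmbeddingLike.apply_eq_iff_eq, Sum.inr.injEq]

lemma dot_update {F : ℕ} (w x : Fin F → ℝ) (k : Fin F) (s : ℝ) :
    dot (Function.update w k s) x = dot w x + (s - w k) * x k := by
  have : ∀ i, Function.update w k s i * x i = w i * x i + if i = k then (s - w k) * x k else 0 := by
    intro i
    by_cases h : i = k
    · subst h; simp; ring
    · simp [h]
  simp [dot, this, Finset.sum_add_distrib]

lemma pderiv_a {F : ℕ} {σ : ℝ → ℝ} (hσ : Differentiable ℝ σ) (n : ℕ)
    (θ : TParam (dlist (n+1)) F → ℝ) (x : Fin F → ℝ) (k : Fin F) :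
    pderiv (fun θ' => treeF σ (dlist (n+1)) θ' x) θ (dlE n F (Sum.inl k))
      = deriv σ (dot (dlA n F θ) x) * x k * (dlB n F θ - treeF σ (dlist n) (dlC n F θ) x) := by
  unfold pderiv
  simp only [treeF_succ, dlA_update_inl, dlB_update_inl, dlC_update_inl, dot_update]
  have hv : θ (dlE n F (Sum.inl k)) = dlA n F θ k := rfl
  rw [hv]
  have h1 : HasDerivAt (fun s => dot (dlA n F θ) x + (s - dlA n F θ k) * x k) (x k)
      (dlA n F θ k) := by
    simpa using (((hasDerivAt_id (dlA n F θ k)).sub_const (dlA n F θ k)).mul_const (x k)).const_add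
      (dot (dlA n F θ) x)
  have h2 : HasDerivAt (fun s => σ (dot (dlA n F θ) x + (s - dlA n F θ k) * x k))
      (deriv σ (dot (dlA n F θ) x) * x k) (dlA n F θ k) := by
    have h0 : HasDerivAt σ (deriv σ (dot (dlA n F θ) x))
        (dot (dlA n F θ) x + (dlA n F θ k - dlA n F θ k) * x k) := by
      simpa using (hσ (dot (dlA n F θ) x)).hasDerivAt
    exact h0.comp (dlA n F θ k) h1
  have h3 := (h2.mul_const (dlB n F θ)).add
    ((h2.const_sub 1).mul_const (treeF σ (dlist n) (dlC n F θ) x))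
  have := h3.deriv
  simp only [Pi.add_def] at this
  rw [this]
  ring

lemma pderiv_b {F : ℕ} {σ : ℝ → ℝ} (n : ℕ)
    (θ : TParam (dlist (n+1)) F → ℝ) (x : Fin F → ℝ) (u : Unit) :
    pderiv (fun θ' => treeF σ (dlist (n+1)) θ' x) θ (dlE n F (Sum.inr (Sum.inl u)))
      = σ (dot (dlA n F θ) x) := by
  unfold pderiv
  simp only [treeF_succ, dlA_update_inr, dlB_update_b, dlC_update_b]
  simp

lemma pderiv_c {F : ℕ} {σ : ℝ → ℝ} (n : ℕ)
    (θ : TParam (dlist (n+1)) F → ℝ) (x : Fin F → ℝ) (q : TParam (dlist n) F) :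
    pderiv (fun θ' => treeF σ (dlist (n+1)) θ' x) θ (dlE n F (Sum.inr (Sum.inr q)))
      = (1 - σ (dot (dlA n F θ) x)) * pderiv (fun θ' => treeF σ (dlist n) θ' x) (dlC n F θ) q := by
  unfold pderiv
  simp only [treeF_succ, dlA_update_inr, dlB_update_c, dlC_update_c]
  rw [deriv_const_add, deriv_const_mul_field]
  rfl

lemma ntk_zero {F : ℕ} (σ : ℝ → ℝ) (θ : TParam (dlist 0) F → ℝ) (xi xj : Fin F → ℝ) :
    empNTK (treeF σ (dlist 0)) θ xi xj = 1 := by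
  have hn : (dlist 0).nodeFinset = ∅ := by simp [dlist, BTree.nodeFinset, BTree.nodePaths]
  have hl : [] ∈ (dlist 0).leafFinset := by simp [dlist, BTree.leafFinset, BTree.leafPaths]
  have hu : ∀ q : TParam (dlist 0) F, q = Sum.inr ⟨[], hl⟩ := by
    rintro (⟨⟨a, ha⟩, k⟩ | ⟨a, ha⟩)
    · simp [hn] at ha
    · have : a = [] := by simpa [dlist, BTree.leafFinset, BTree.leafPaths] using ha
      subst this; rfl
  have hs : (Finset.univ : Finset (TParam (dlist 0) F)) = {Sum.inr ⟨[], hl⟩} := by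
    ext q; simp [← hu q]
  unfold empNTK
  rw [hs, Finset.sum_singleton]
  simp [pderiv, treeF_zero]

lemma ntk_succ {F : ℕ} {σ : ℝ → ℝ} (hσ : Differentiable ℝ σ) (n : ℕ)
    (θ : TParam (dlist (n+1)) F → ℝ) (xi xj : Fin F → ℝ) :
    empNTK (treeF σ (dlist (n+1))) θ xi xj =
      (dot xi xj * (deriv σ (dot (dlA n F θ) xi) * deriv σ (dot (dlA n F θ) xj))) *
        ((dlB n F θ - treeF σ (dlist n) (dlC n F θ) xi) *
          (dlB n F θ - treeF σ (dlist n) (dlC n F θ) xj))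
      + σ (dot (dlA n F θ) xi) * σ (dot (dlA n F θ) xj)
      + ((1 - σ (dot (dlA n F θ) xi)) * (1 - σ (dot (dlA n F θ) xj))) *
        empNTK (treeF σ (dlist n)) (dlC n F θ) xi xj := by
  unfold empNTK
  rw [← (dlE n F).sum_comp, Fintype.sum_sum_type, Fintype.sum_sum_type]
  simp only [pderiv_a hσ, pderiv_b, pderiv_c]
  rw [Finset.mul_sum, show dot xi xj = ∑ k, xi k * xj k from rfl, Finset.sum_mul, Finset.sum_mul, add_assoc]
  congr 1
  · apply Finset.sum_congr rfl; intros; ring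
  · congr 1
    · simp
    · apply Finset.sum_congr rfl; intros; ring

lemma ens_ntk {F : ℕ} (σ : ℝ → ℝ) (t : BTree) (M : ℕ) (θ : Fin M × TParam t F → ℝ)
    (xi xj : Fin F → ℝ) :
    empNTK (ensembleF σ t M) θ xi xj =
      (1 / (M:ℝ)) * ∑ m : Fin M, empNTK (treeF σ t) (fun p => θ (m, p)) xi xj := by
  have hp : ∀ x m p, pderiv (fun θ' => ensembleF σ t M θ' x) θ (m, p) =
      (1 / Real.sqrt M) * pderiv (fun θ' => treeF σ t θ' x) (fun p => θ (m, p)) p := by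
    intro x m p
    unfold pderiv ensembleF
    rw [deriv_const_mul_field]
    congr 1
    have : ∀ s, ∑ m' : Fin M, treeF σ t (fun q => Function.update θ (m, p) s (m', q)) x
        = treeF σ t (Function.update (fun q => θ (m, q)) p s) x +
          ∑ m' ∈ Finset.univ.erase m, treeF σ t (fun q => θ (m', q)) x := by
      intro s
      rw [← Finset.add_sum_erase _ _ (Finset.mem_univ m)]
      congr 1
      · congr 1
        funext q
        simp [Function.update_apply]
      · apply Finset.sum_congr rfl
        intro m' hm'
        congr 1
        funext q
        have : m' ≠ m := Finset.ne_of_mem_erase hm'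
        simp [Function.update_apply, this]
    simp only [this]
    rw [deriv_add_const]
  unfold empNTK
  rw [Fintype.sum_prod_type, Finset.mul_sum]
  apply Finset.sum_congr rfl
  intro m _
  rw [Finset.mul_sum]
  apply Finset.sum_congr rfl
  intro p _
  rw [hp, hp]
  have : (1 / (M:ℝ)) = (1 / Real.sqrt M) * (1 / Real.sqrt M) := by
    rw [div_mul_div_comm, Real.mul_self_sqrt (by positivity)]; simp
  rw [this]; ring

def SS (T : ℝ) : ℕ → ℝ
  | 0 => 1
  | n + 1 => T + T * SS T n

def KK (T c : ℝ) : ℕ → ℝ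
  | 0 => 1
  | n + 1 => c * (1 + SS T n) + T + T * KK T c n

lemma sum_pow_succ (T : ℝ) (n : ℕ) :
    ∑ d ∈ Finset.Icc 1 (n+1), T^d = T + T * ∑ d ∈ Finset.Icc 1 n, T^d := by
  induction n with
  | zero => simp
  | succ n ih =>
    rw [Finset.sum_Icc_succ_top (by omega)]
    have h := Finset.sum_Icc_succ_top (a := 1) (b := n) (by omega) (fun d => T^d)
    linear_combination ih - T * h

lemma mul_pow_pred (T : ℝ) (n : ℕ) : ((n + 1 : ℕ) : ℝ) * T^n = T^n + T * (n * T^(n-1)) := by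
  cases n with
  | zero => simp
  | succ n => simp only [Nat.add_sub_cancel]; push_cast; ring

lemma sum_dpow_succ (T : ℝ) (n : ℕ) :
    ∑ d ∈ Finset.Icc 1 (n+1), (d:ℝ) * T^(d-1) =
      1 + ∑ d ∈ Finset.Icc 1 n, T^d + T * ∑ d ∈ Finset.Icc 1 n, (d:ℝ) * T^(d-1) := by
  induction n with
  | zero => simp
  | succ n ih =>
    rw [Finset.sum_Icc_succ_top (by omega)]
    have hA := Finset.sum_Icc_succ_top (a := 1) (b := n) (by omega) (fun d => T^d)
    have hB := Finset.sum_Icc_succ_top (a := 1) (b := n) (by omega) (fun d => (d:ℝ) * T^(d-1))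
    have := mul_pow_pred T (n+1)
    simp only [Nat.add_sub_cancel] at this hA hB ih ⊢
    linear_combination ih + this - hA - T * hB

lemma SS_closed (T : ℝ) (n : ℕ) : SS T n = ∑ d ∈ Finset.Icc 1 n, T^d + T^n := by
  induction n with
  | zero => simp [SS]
  | succ n ih => rw [SS, ih, sum_pow_succ]; ring

lemma KK_closed (T c : ℝ) (n : ℕ) : KK T c n =
    c * ((∑ d ∈ Finset.Icc 1 n, (d : ℝ) * T^(d-1)) + (n : ℝ) * T^(n-1))
      + (∑ d ∈ Finset.Icc 1 n, T^d) + T^n := by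
  induction n with
  | zero => simp [KK]
  | succ n ih =>
    rw [KK, ih, SS_closed, sum_pow_succ, sum_dpow_succ, Nat.add_sub_cancel, mul_pow_pred]; ring

instance (F : ℕ) : IsProbabilityMeasure (stdGauss F) := by unfold stdGauss; infer_instance
instance (ι : Type) [Fintype ι] : IsProbabilityMeasure (initMeasure ι) := by
  unfold initMeasure; infer_instance

lemma mp_reindex {α β : Type} [Fintype α] [Fintype β] (e : α ≃ β) :
    MeasurePreserving (fun (θ : β → ℝ) (a : α) => θ (e a)) (initMeasure β) (initMeasure α) := by
  have h := (measurePreserving_piCongrLeft (α := fun _ : β => ℝ)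
    (fun _ : β => gaussianReal 0 1) e).symm
  exact h

lemma mp_curry (M : ℕ) (β : Type) [Fintype β] :
    MeasurePreserving (MeasurableEquiv.curry (Fin M) β ℝ) (initMeasure (Fin M × β))
      (Measure.pi fun _ : Fin M => initMeasure β) := by
  refine ⟨(MeasurableEquiv.curry (Fin M) β ℝ).measurable, ?_⟩
  have := Measure.infinitePi_map_curry (fun (_ : Fin M) (_ : β) => gaussianReal 0 1)
  simp only [Measure.infinitePi_eq_pi] at this
  exact this

lemma mp_split (n F : ℕ) :
    MeasurePreserving (fun θ => (dlA n F θ, (dlB n F θ, dlC n F θ)))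
      (initMeasure (TParam (dlist (n+1)) F))
      ((stdGauss F).prod ((gaussianReal 0 1).prod (initMeasure (TParam (dlist n) F)))) := by
  have h1 := mp_reindex (dlE n F)
  have h2 := measurePreserving_sumPiEquivProdPi
    (X := fun _ : Fin F ⊕ (Unit ⊕ TParam (dlist n) F) => ℝ) (fun _ => gaussianReal 0 1)
  have h3 := measurePreserving_sumPiEquivProdPi
    (X := fun _ : Unit ⊕ TParam (dlist n) F => ℝ) (fun _ => gaussianReal 0 1)
  have h4 := measurePreserving_eval (fun _ : Unit => gaussianReal 0 1) ()
  have h5 := (h4.prod (MeasurePreserving.id (initMeasure (TParam (dlist n) F)))).comp h3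
  have h6 := ((MeasurePreserving.id (stdGauss F)).prod h5).comp (h2.comp h1)
  exact h6

lemma mp_neg (F : ℕ) : MeasurePreserving (fun (u : Fin F → ℝ) i => - u i)
    (stdGauss F) (stdGauss F) := by
  refine measurePreserving_pi (fun _ => gaussianReal 0 1) (fun _ => gaussianReal 0 1)
    (f := fun _ x => -x) fun i => ?_
  exact ⟨by fun_prop, by simpa using gaussianReal_map_neg (μ := 0) (v := 1)⟩

@[fun_prop]
lemma dot_meas {F : ℕ} (x : Fin F → ℝ) : Measurable (fun u : Fin F → ℝ => dot u x) := by
  unfold dot; fun_prop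

lemma Tker_neg {F : ℕ} {σ : ℝ → ℝ} (hσ : IsDecisionFunc σ) (xi xj : Fin F → ℝ) :
    ∫ u, (1 - σ (dot u xi)) * (1 - σ (dot u xj)) ∂ stdGauss F = Tker σ xi xj := by
  have hm : Measurable σ := hσ.differentiable.continuous.measurable
  have hd : ∀ (u x : Fin F → ℝ), dot (fun i => - u i) x = - dot u x := by
    intro u x; simp [dot]
  have hs : ∀ p, 1 - σ p = σ (-p) := fun p => by linarith [hσ.symm p]
  unfold Tker
  have h := (mp_neg F).map_eq
  conv_rhs => rw [← h]
  rw [integral_map (mp_neg F).measurable.aemeasurable]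
  · simp only [hd, hs]
  · apply Measurable.aestronglyMeasurable
    exact (hm.comp (dot_meas xi)).mul (hm.comp (dot_meas xj))

lemma memLp_bdd_mul {Ω : Type} [MeasurableSpace Ω] {μ : Measure Ω} {p : ENNReal} {b g : Ω → ℝ}
    (C : ℝ) (hg : MemLp g p μ) (hb : Measurable b) (hC : ∀ x, |b x| ≤ C) :
    MemLp (fun x => b x * g x) p μ := by
  refine hg.of_le_mul (c := C) (hb.aestronglyMeasurable.mul hg.1) (ae_of_all _ fun x => ?_)
  rw [norm_mul]
  exact mul_le_mul_of_nonneg_right (hC x) (norm_nonneg _)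

instance holder442 : ENNReal.HolderTriple 4 4 2 := ⟨by
  have h : (4:ENNReal) = 2 * 2 := by norm_num
  rw [h, ENNReal.mul_inv (by simp) (by simp), ← mul_add, ENNReal.inv_two_add_inv_two, mul_one]⟩

lemma integral_mp {Ω Ω' : Type} [MeasurableSpace Ω] [MeasurableSpace Ω'] {μ : Measure Ω}
    {ν : Measure Ω'} {φ : Ω → Ω'} (h : MeasurePreserving φ μ ν) {g : Ω' → ℝ}
    (hg : AEStronglyMeasurable g ν) : ∫ x, g (φ x) ∂μ = ∫ y, g y ∂ν := by
  rw [← h.map_eq, integral_map h.measurable.aemeasurable (h.map_eq.symm ▸ hg)]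

lemma gauss_sq : ∫ x, x * x ∂(gaussianReal 0 1) = 1 := by
  have h := variance_id_gaussianReal (μ := 0) (v := 1)
  rw [variance_eq_sub (memLp_id_gaussianReal 2)] at h
  simpa [pow_two] using h

lemma sig_bdd {σ : ℝ → ℝ} (hσ : IsDecisionFunc σ) (p : ℝ) : |σ p| ≤ 1 := by
  have := hσ.mem_Icc p
  rw [abs_le]; constructor <;> linarith [this.1, this.2]

lemma sig_bdd' {σ : ℝ → ℝ} (hσ : IsDecisionFunc σ) (p : ℝ) : |1 - σ p| ≤ 1 := by
  have := hσ.mem_Icc p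
  rw [abs_le]; constructor <;> linarith [this.1, this.2]

lemma bdd_int {F : ℕ} {b c : ℝ → ℝ} (hb : Measurable b) (hc : Measurable c) {B C : ℝ}
    (hB : ∀ p, |b p| ≤ B) (hC : ∀ p, |c p| ≤ C) (x y : Fin F → ℝ) :
    Integrable (fun u => b (dot u x) * c (dot u y)) (stdGauss F) := by
  refine Integrable.of_bound (C := B * C) ?_ (ae_of_all _ fun u => ?_)
  · exact ((hb.comp (dot_meas x)).mul (hc.comp (dot_meas y))).aestronglyMeasurable
  · rw [norm_mul]
    exact mul_le_mul (hB _) (hC _) (abs_nonneg _) ((abs_nonneg _).trans (hB 0))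

lemma main_step {F : ℕ} {σ : ℝ → ℝ} (hσ : IsDecisionFunc σ) (xi xj : Fin F → ℝ) (n : ℕ) :
    (∀ x, MemLp (fun θ => treeF σ (dlist n) θ x) 4 (initMeasure (TParam (dlist n) F))) ∧
    (∫ θ, treeF σ (dlist n) θ xi * treeF σ (dlist n) θ xj ∂(initMeasure (TParam (dlist n) F))
      = SS (Tker σ xi xj) n) ∧
    MemLp (fun θ => empNTK (treeF σ (dlist n)) θ xi xj) 2 (initMeasure (TParam (dlist n) F)) ∧
    (∫ θ, empNTK (treeF σ (dlist n)) θ xi xj ∂(initMeasure (TParam (dlist n) F))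
      = KK (Tker σ xi xj) (dot xi xj * Tdot σ xi xj) n) := by
  have hm : Measurable σ := hσ.differentiable.continuous.measurable
  have hm' : Measurable (fun p => 1 - σ p) := measurable_const.sub hm
  have hdm : Measurable (deriv σ) := measurable_deriv σ
  obtain ⟨Cd, hCd⟩ := hσ.deriv_bounded
  have hid4 : MemLp (fun x : ℝ => x) 4 (gaussianReal 0 1) := memLp_id_gaussianReal 4
  induction n with
  | zero =>
    have he := measurePreserving_eval (fun _ : TParam (dlist 0) F => gaussianReal 0 1)
      (Sum.inr ⟨[], by simp [dlist, BTree.leafFinset, BTree.leafPaths]⟩)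
    refine ⟨fun x => ?_, ?_, ?_, ?_⟩
    · simp only [treeF_zero]
      exact hid4.comp_measurePreserving he
    · simp only [treeF_zero, SS]
      rw [← gauss_sq]
      exact integral_mp he (g := fun x => x * x)
        (by fun_prop)
    · simp only [ntk_zero]
      exact memLp_const 1
    · simp [ntk_zero, KK]
  | succ n ih =>
    obtain ⟨ih1, ih2, ih3, ih4⟩ := ih
    set P := initMeasure (TParam (dlist n) F) with hP
    set f : (Fin F → ℝ) → (TParam (dlist n) F → ℝ) → ℝ := fun x θ => treeF σ (dlist n) θ x with hf
    set K : (TParam (dlist n) F → ℝ) → ℝ := fun θ => empNTK (treeF σ (dlist n)) θ xi xj with hK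
    have hφ := mp_split n F
    have hπ4 : MemLp (fun z : ℝ × (TParam (dlist n) F → ℝ) => z.1) 4 ((gaussianReal 0 1).prod P) :=
      hid4.comp_fst P
    have hf4 : ∀ x, MemLp (fun z : ℝ × (TParam (dlist n) F → ℝ) => f x z.2) 4
        ((gaussianReal 0 1).prod P) := fun x => (ih1 x).comp_snd _
    have hK2 : MemLp (fun z : ℝ × (TParam (dlist n) F → ℝ) => K z.2) 2
        ((gaussianReal 0 1).prod P) := ih3.comp_snd _
    have m2 : ∀ {g h : ℝ × (TParam (dlist n) F → ℝ) → ℝ},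
        MemLp g 4 ((gaussianReal 0 1).prod P) → MemLp h 4 ((gaussianReal 0 1).prod P) →
        MemLp (fun z => g z * h z) 2 ((gaussianReal 0 1).prod P) := fun hg hh => hh.mul' hg
    have i1 : ∀ {g : ℝ × (TParam (dlist n) F → ℝ) → ℝ},
        MemLp g 2 ((gaussianReal 0 1).prod P) → Integrable g ((gaussianReal 0 1).prod P) :=
      fun hg => hg.integrable (by norm_num)
    have e1 : ∫ z : ℝ × (TParam (dlist n) F → ℝ), z.1 * z.1 ∂((gaussianReal 0 1).prod P) = 1 := by
      have := integral_prod_mul (μ := gaussianReal 0 1) (ν := P) (fun x : ℝ => x * x) (fun _ => (1:ℝ))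
      simpa [gauss_sq] using this
    have e2 : ∀ x, ∫ z : ℝ × (TParam (dlist n) F → ℝ), z.1 * f x z.2 ∂((gaussianReal 0 1).prod P)
        = 0 := by
      intro x
      have := integral_prod_mul (μ := gaussianReal 0 1) (ν := P) (fun x : ℝ => x) (f x)
      rw [this, integral_id_gaussianReal, zero_mul]
    have e3 : ∫ z : ℝ × (TParam (dlist n) F → ℝ), f xi z.2 * f xj z.2 ∂((gaussianReal 0 1).prod P)
        = SS (Tker σ xi xj) n := by
      have := integral_prod_mul (μ := gaussianReal 0 1) (ν := P) (fun _ : ℝ => (1:ℝ))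
        (fun θ => f xi θ * f xj θ)
      simp only [one_mul] at this
      rw [this, ih2]; simp
    have e4 : ∫ z : ℝ × (TParam (dlist n) F → ℝ), K z.2 ∂((gaussianReal 0 1).prod P)
        = KK (Tker σ xi xj) (dot xi xj * Tdot σ xi xj) n := by
      have := integral_prod_mul (μ := gaussianReal 0 1) (ν := P) (fun _ : ℝ => (1:ℝ)) K
      simp only [one_mul] at this
      rw [this, ih4]; simp
    have e5 : ∫ z : ℝ × (TParam (dlist n) F → ℝ), (z.1 - f xi z.2) * (z.1 - f xj z.2)
        ∂((gaussianReal 0 1).prod P) = 1 + SS (Tker σ xi xj) n := by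
      have hh : ∀ z : ℝ × (TParam (dlist n) F → ℝ), (z.1 - f xi z.2) * (z.1 - f xj z.2) =
        ((z.1 * z.1 - z.1 * f xi z.2) - z.1 * f xj z.2) + f xi z.2 * f xj z.2 := fun z => by ring
      simp only [hh]
      rw [integral_add, integral_sub, integral_sub, e1, e2, e2, e3]
      · ring
      · exact i1 (m2 hπ4 hπ4)
      · exact i1 (m2 hπ4 (hf4 xi))
      · exact (i1 (m2 hπ4 hπ4)).sub (i1 (m2 hπ4 (hf4 xi)))
      · exact i1 (m2 hπ4 (hf4 xj))
      · exact ((i1 (m2 hπ4 hπ4)).sub (i1 (m2 hπ4 (hf4 xi)))).sub (i1 (m2 hπ4 (hf4 xj)))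
      · exact i1 (m2 (hf4 xi) (hf4 xj))
    have hsub2 : MemLp (fun z : ℝ × (TParam (dlist n) F → ℝ) =>
        (z.1 - f xi z.2) * (z.1 - f xj z.2)) 2 ((gaussianReal 0 1).prod P) :=
      m2 (hπ4.sub (hf4 xi)) (hπ4.sub (hf4 xj))
    set R := (gaussianReal 0 1).prod P with hR
    have hF4 : ∀ x, MemLp (fun z : (Fin F → ℝ) × ℝ × (TParam (dlist n) F → ℝ) =>
        σ (dot z.1 x) * z.2.1 + (1 - σ (dot z.1 x)) * f x z.2.2) 4 ((stdGauss F).prod R) := by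
      intro x
      refine MemLp.add (memLp_bdd_mul 1 (hπ4.comp_snd _) ?_ fun z => sig_bdd hσ _)
        (memLp_bdd_mul 1 ((hf4 x).comp_snd _) ?_ fun z => sig_bdd' hσ _)
      · exact hm.comp ((dot_meas x).comp measurable_fst)
      · exact hm'.comp ((dot_meas x).comp measurable_fst)
    have hN2 : MemLp (fun z : (Fin F → ℝ) × ℝ × (TParam (dlist n) F → ℝ) =>
        (dot xi xj * (deriv σ (dot z.1 xi) * deriv σ (dot z.1 xj))) *
          ((z.2.1 - f xi z.2.2) * (z.2.1 - f xj z.2.2)) +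
        (σ (dot z.1 xi) * σ (dot z.1 xj)) * 1 +
        ((1 - σ (dot z.1 xi)) * (1 - σ (dot z.1 xj))) * K z.2.2) 2 ((stdGauss F).prod R) := by
      refine MemLp.add (MemLp.add
        (memLp_bdd_mul (|dot xi xj| * (Cd * Cd)) (hsub2.comp_snd _) ?_ fun z => ?_)
        (memLp_bdd_mul (1 * 1) (memLp_const 1) ?_ fun z => ?_))
        (memLp_bdd_mul (1 * 1) (hK2.comp_snd _) ?_ fun z => ?_)
      · exact ((hdm.comp ((dot_meas xi).comp measurable_fst)).mul
          (hdm.comp ((dot_meas xj).comp measurable_fst))).const_mul _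
      · rw [abs_mul, abs_mul]
        exact mul_le_mul_of_nonneg_left (mul_le_mul (hCd _) (hCd _) (abs_nonneg _)
          ((abs_nonneg _).trans (hCd 0))) (abs_nonneg _)
      · exact (hm.comp ((dot_meas xi).comp measurable_fst)).mul
          (hm.comp ((dot_meas xj).comp measurable_fst))
      · rw [abs_mul]
        exact mul_le_mul (sig_bdd hσ _) (sig_bdd hσ _) (abs_nonneg _) zero_le_one
      · exact (hm'.comp ((dot_meas xi).comp measurable_fst)).mul
          (hm'.comp ((dot_meas xj).comp measurable_fst))
      · rw [abs_mul]
        exact mul_le_mul (sig_bdd' hσ _) (sig_bdd' hσ _) (abs_nonneg _) zero_le_one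
    have b11 := bdd_int hm hm (sig_bdd hσ) (sig_bdd hσ) xi xj
    have b12 := bdd_int hm hm' (sig_bdd hσ) (sig_bdd' hσ) xi xj
    have b21 := bdd_int hm' hm (sig_bdd' hσ) (sig_bdd hσ) xi xj
    have b22 := bdd_int hm' hm' (sig_bdd' hσ) (sig_bdd' hσ) xi xj
    have bdd := (bdd_int hdm hdm hCd hCd xi xj).const_mul (dot xi xj)
    refine ⟨fun x => ?_, ?_, ?_, ?_⟩
    · simp only [treeF_succ]
      exact (hF4 x).comp_measurePreserving hφ
    · simp only [treeF_succ]
      rw [integral_mp hφ (g := fun z : (Fin F → ℝ) × ℝ × (TParam (dlist n) F → ℝ) =>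
        (σ (dot z.1 xi) * z.2.1 + (1 - σ (dot z.1 xi)) * f xi z.2.2) *
        (σ (dot z.1 xj) * z.2.1 + (1 - σ (dot z.1 xj)) * f xj z.2.2)) ((hF4 xi).1.mul (hF4 xj).1)]
      have hh : ∀ z : (Fin F → ℝ) × ℝ × (TParam (dlist n) F → ℝ),
        (σ (dot z.1 xi) * z.2.1 + (1 - σ (dot z.1 xi)) * f xi z.2.2) *
        (σ (dot z.1 xj) * z.2.1 + (1 - σ (dot z.1 xj)) * f xj z.2.2) =
        (((σ (dot z.1 xi) * σ (dot z.1 xj)) * (z.2.1 * z.2.1) +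
        (σ (dot z.1 xi) * (1 - σ (dot z.1 xj))) * (z.2.1 * f xj z.2.2)) +
        ((1 - σ (dot z.1 xi)) * σ (dot z.1 xj)) * (z.2.1 * f xi z.2.2)) +
        ((1 - σ (dot z.1 xi)) * (1 - σ (dot z.1 xj))) * (f xi z.2.2 * f xj z.2.2) :=
        fun z => by ring
      simp only [hh]
      have j1 := b11.mul_prod (i1 (m2 hπ4 hπ4))
      have j2 := b12.mul_prod (i1 (m2 hπ4 (hf4 xj)))
      have j3 := b21.mul_prod (i1 (m2 hπ4 (hf4 xi)))
      have j4 := b22.mul_prod (i1 (m2 (hf4 xi) (hf4 xj)))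
      have k1 := integral_prod_mul (μ := stdGauss F) (ν := R)
        (fun u => σ (dot u xi) * σ (dot u xj)) (fun z => z.1 * z.1)
      have k2 := integral_prod_mul (μ := stdGauss F) (ν := R)
        (fun u => σ (dot u xi) * (1 - σ (dot u xj))) (fun z => z.1 * f xj z.2)
      have k3 := integral_prod_mul (μ := stdGauss F) (ν := R)
        (fun u => (1 - σ (dot u xi)) * σ (dot u xj)) (fun z => z.1 * f xi z.2)
      have k4 := integral_prod_mul (μ := stdGauss F) (ν := R)
        (fun u => (1 - σ (dot u xi)) * (1 - σ (dot u xj))) (fun z => f xi z.2 * f xj z.2)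
      rw [integral_add ((j1.fun_add j2).fun_add j3) j4, integral_add (j1.fun_add j2) j3, integral_add j1 j2,
        k1, k2, k3, k4, e1, e2, e2, e3, Tker_neg hσ, SS]
      simp only [Tker]; ring
    · simp only [ntk_succ hσ.differentiable]
      have := hN2.comp_measurePreserving hφ
      simp only [mul_one] at this
      exact this
    · simp only [ntk_succ hσ.differentiable]
      have j1 := bdd.mul_prod (i1 hsub2)
      have j2 := b11.mul_prod (integrable_const (μ := R) (1:ℝ))
      have j3 := b22.mul_prod (i1 hK2)
      have k1 := integral_prod_mul (μ := stdGauss F) (ν := R)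
        (fun u => dot xi xj * (deriv σ (dot u xi) * deriv σ (dot u xj)))
        (fun z => (z.1 - f xi z.2) * (z.1 - f xj z.2))
      have k2 := integral_prod_mul (μ := stdGauss F) (ν := R)
        (fun u => σ (dot u xi) * σ (dot u xj)) (fun z => (1:ℝ))
      have k3 := integral_prod_mul (μ := stdGauss F) (ν := R)
        (fun u => (1 - σ (dot u xi)) * (1 - σ (dot u xj))) (fun z => K z.2)
      have := integral_mp hφ hN2.1
      rw [integral_add (j1.fun_add j2) j3, integral_add j1 j2, k1, k2, k3, e5, e4, Tker_neg hσ,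
        integral_const_mul] at this
      simp only [mul_one] at this
      refine this.trans ?_
      simp [KK, Tker, Tdot]

lemma lln {Ω : Type} [MeasurableSpace Ω] (P : Measure Ω) [IsProbabilityMeasure P] {K : Ω → ℝ}
    (hK : MemLp K 2 P) (ε : ℝ) (hε : 0 < ε) :
    Tendsto (fun M : ℕ => (Measure.pi fun _ : Fin M => P)
      {θ | ε ≤ |(1 / (M:ℝ)) * ∑ m : Fin M, K (θ m) - ∫ ω, K ω ∂P|}) atTop (nhds 0) := by
  have hbound : ∀ M : ℕ, 0 < M → (Measure.pi fun _ : Fin M => P)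
      {θ | ε ≤ |(1 / (M:ℝ)) * ∑ m : Fin M, K (θ m) - ∫ ω, K ω ∂P|}
      ≤ ENNReal.ofReal ((variance K P / ε ^ 2) / M) := by
    intro M hM
    have hM' : (M:ℝ) ≠ 0 := by positivity
    have hev : ∀ m : Fin M, MemLp (fun θ : Fin M → Ω => K (θ m)) 2
        (Measure.pi fun _ : Fin M => P) := fun m =>
      hK.comp_measurePreserving (measurePreserving_eval _ m)
    have hsum : MemLp (∑ m : Fin M, fun θ : Fin M → Ω => K (θ m)) 2
        (Measure.pi fun _ : Fin M => P) := memLp_finsetSum' _ fun m _ => hev m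
    have hX := hsum.const_mul (1 / (M:ℝ))
    have hint : ∫ θ, (1 / (M:ℝ)) * (∑ m : Fin M, fun θ : Fin M → Ω => K (θ m)) θ
        ∂(Measure.pi fun _ : Fin M => P) = ∫ ω, K ω ∂P := by
      rw [integral_const_mul]
      simp only [Finset.sum_apply]
      rw [integral_finsetSum _ fun m _ => (hev m).integrable (by norm_num)]
      have : ∀ m : Fin M, ∫ θ : Fin M → Ω, K (θ m) ∂(Measure.pi fun _ : Fin M => P)
          = ∫ ω, K ω ∂P := fun m =>
        integral_mp (measurePreserving_eval (fun _ : Fin M => P) m) hK.1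
      simp only [this]
      simp [hM']
    have h := meas_ge_le_variance_div_sq hX hε
    rw [hint, variance_const_mul, variance_sum_pi (fun _ => hK)] at h
    simp only [Finset.sum_apply] at h
    refine h.trans (le_of_eq ?_)
    congr 1
    simp
    field_simp
  have hlim : Tendsto (fun M : ℕ => ENNReal.ofReal ((variance K P / ε ^ 2) / M)) atTop (nhds 0) := by
    rw [← ENNReal.ofReal_zero]
    exact ENNReal.tendsto_ofReal (tendsto_const_div_atTop_nhds_zero_nat _)
  refine tendsto_of_tendsto_of_tendsto_of_le_of_le' tendsto_const_nhds hlim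
    (Eventually.of_forall fun _ => bot_le) ?_
  filter_upwards [eventually_gt_atTop 0] with M hM using hbound M hM

/-- The empirical NTK at the NTK initialization of an ensemble of `M` soft decision lists
of depth `D` converges in probability, as `M → ∞`, to
`Θ^{(D,DL)} = ∑_{d=1}^{D−1} Θ^{(d,Rule)} + 2·Θ^{(D,Rule)}
 = Σ·Ṫ·(∑_{d=1}^D d·T^{d−1} + D·T^{D−1}) + ∑_{d=1}^D T^d + T^D`. -/
theorem stmt11 (F D : ℕ) (hF : 1 ≤ F) (hD : 1 ≤ D) (σ : ℝ → ℝ) (hσ : IsDecisionFunc σ)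
    (xi xj : Fin F → ℝ) :
    (∑ d ∈ Finset.Icc 1 (D - 1), thetaRule σ d xi xj) + 2 * thetaRule σ D xi xj
      = dot xi xj * Tdot σ xi xj *
          ((∑ d ∈ Finset.Icc 1 D, (d : ℝ) * (Tker σ xi xj)^(d-1))
            + (D : ℝ) * (Tker σ xi xj)^(D-1))
        + (∑ d ∈ Finset.Icc 1 D, (Tker σ xi xj)^d) + (Tker σ xi xj)^D ∧
    ∀ ε > (0:ℝ), Tendsto
      (fun M : ℕ => initMeasure (Fin M × TParam (dlist D) F)
        {θ | ε ≤ |empNTK (ensembleF σ (dlist D) M) θ xi xj -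
          (dot xi xj * Tdot σ xi xj *
            ((∑ d ∈ Finset.Icc 1 D, (d : ℝ) * (Tker σ xi xj)^(d-1))
              + (D : ℝ) * (Tker σ xi xj)^(D-1))
          + (∑ d ∈ Finset.Icc 1 D, (Tker σ xi xj)^d) + (Tker σ xi xj)^D)|})
      atTop (nhds 0) := by
  have hcl := KK_closed (Tker σ xi xj) (dot xi xj * Tdot σ xi xj) D
  refine ⟨?_, fun ε hε => ?_⟩
  · obtain ⟨n, rfl⟩ : ∃ n, D = n + 1 := ⟨D - 1, by omega⟩
    rw [Finset.sum_Icc_succ_top (by omega), Finset.sum_Icc_succ_top (by omega)]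
    simp only [Nat.add_sub_cancel, thetaRule, Finset.sum_add_distrib]
    have : ∑ d ∈ Finset.Icc 1 n, (d:ℝ) * dot xi xj * Tker σ xi xj ^ (d-1) * Tdot σ xi xj =
        dot xi xj * Tdot σ xi xj * ∑ d ∈ Finset.Icc 1 n, (d:ℝ) * Tker σ xi xj ^ (d-1) := by
      rw [Finset.mul_sum]
      apply Finset.sum_congr rfl; intros; ring
    rw [this]; ring
  · rw [← hcl]
    obtain ⟨-, -, h3, h4⟩ := main_step hσ xi xj D
    have h := lln _ h3 ε hε
    rw [h4] at h
    refine h.congr fun M => ?_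
    rw [← (mp_curry M (TParam (dlist D) F)).measure_preimage_equiv]
    congr 1
    ext θ
    simp only [Set.mem_preimage, Set.mem_setOf_eq, ens_ntk]
    rfl

end
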